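/- arXiv:1911.13284 — 3 statements merged into one kernel-verified Lean document; each statement's English description precedes it below -/
import Mathlib

section
/- Let n ≥ 5, G = S_n acting naturally on {1,…,n}, and let π₁ and π₂ be the permutation characters of the actions of G on {1,…,n} and on the set of 2-element subsets of {1,…,n}, respectively (so π₁(g) is the number of fixed points of g and π₂(g) is the number of 2-element subsets fixed setwise by g). Then α := π₂ − π₁ is an irreducible character of G (namely χ^{(n−2,2)}), and diam M(G,α) ≤ 2n−2; that is, for all irreducible characters χ₁, χ₂ of G there exists an integer j with 0 ≤ j ≤ 2n−2 such that [α^j·χ₁, χ₂]_G ≠ 0. -/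
open scoped BigOperators

/-- The inner product `[φ,ψ]_G = (1/|G|) ∑_{g∈G} φ(g)·conj(ψ(g))` of two complex-valued
functions on a group `G`. -/
noncomputable def charInner {G : Type} [Group G] (φ ψ : G → ℂ) : ℂ :=
  (Nat.card G : ℂ)⁻¹ * ∑ᶠ g : G, φ g * (starRingEnd ℂ) (ψ g)

/-- `χ` is the character of some finite-dimensional complex representation of `G`. -/
def IsChar (G : Type) [Group G] (χ : G → ℂ) : Prop :=
  ∃ V : FDRep ℂ G, ∀ g, V.character g = χ g

/-- `χ` is the character of some irreducible finite-dimensional complex representation of `G`. -/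
def IsIrrChar (G : Type) [Group G] (χ : G → ℂ) : Prop :=
  ∃ V : FDRep ℂ G, CategoryTheory.Simple V ∧ ∀ g, V.character g = χ g

/-- `χ` is a character of `G` afforded by a faithful (injective) representation. -/
def IsFaithfulChar (G : Type) [Group G] (χ : G → ℂ) : Prop :=
  ∃ V : FDRep ℂ G, Function.Injective (fun g => V.ρ g) ∧ ∀ g, V.character g = χ g

/-- The McKay graph `M(G, α)` has diameter at most `d`: for every ordered pair of
irreducible characters `χ₁, χ₂` there is `0 ≤ j ≤ d` with `[α^j·χ₁, χ₂]_G ≠ 0`. -/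
def McKayDiamLE (G : Type) [Group G] (α : G → ℂ) (d : ℕ) : Prop :=
  ∀ χ₁ χ₂ : G → ℂ, IsIrrChar G χ₁ → IsIrrChar G χ₂ →
    ∃ j ≤ d, charInner (α ^ j * χ₁) χ₂ ≠ 0

/-! ### Characters as traces of representations -/

theorem LinearMap.trace_eq_add_of_exact {k A B K : Type*} [Field k] [AddCommGroup A] [Module k A]
    [AddCommGroup B] [Module k B] [AddCommGroup K] [Module k K] [FiniteDimensional k A]
    [FiniteDimensional k B] [FiniteDimensional k K] (ι : K →ₗ[k] A) (f : A →ₗ[k] B)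
    (hι : Function.Injective ι) (hf : Function.Surjective f)
    (hex : LinearMap.range ι = LinearMap.ker f) (a : A →ₗ[k] A) (b : B →ₗ[k] B) (c : K →ₗ[k] K)
    (hfa : f ∘ₗ a = b ∘ₗ f) (hιa : a ∘ₗ ι = ι ∘ₗ c) :
    LinearMap.trace k A a = LinearMap.trace k B b + LinearMap.trace k K c := by
  obtain ⟨s, hs⟩ := f.exists_rightInverse_of_surjective (LinearMap.range_eq_top.2 hf)
  obtain ⟨r, hr⟩ := ι.exists_leftInverse_of_injective (LinearMap.ker_eq_bot.2 hι)
  have hq : ι ∘ₗ r ∘ₗ (LinearMap.id - s ∘ₗ f) = LinearMap.id - s ∘ₗ f := by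
    ext x
    have hx : (LinearMap.id - s ∘ₗ f : A →ₗ[k] A) x ∈ LinearMap.range ι := by
      rw [hex, LinearMap.mem_ker]
      simpa [sub_eq_zero] using (LinearMap.congr_fun hs (f x)).symm
    obtain ⟨y, hy⟩ := hx
    rw [LinearMap.comp_apply, LinearMap.comp_apply, ← hy]
    exact congrArg ι (LinearMap.congr_fun hr y)
  have hfι : f ∘ₗ ι = 0 := by
    ext y
    have hy := LinearMap.mem_range_self ι y
    rwa [hex] at hy
  have hrι : (r ∘ₗ (LinearMap.id - s ∘ₗ f)) ∘ₗ ι = LinearMap.id := by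
    rw [LinearMap.comp_assoc, LinearMap.sub_comp, LinearMap.comp_assoc, hfι]
    simpa using hr
  have h1 : LinearMap.trace k A (a ∘ₗ s ∘ₗ f) = LinearMap.trace k B b := by
    rw [← LinearMap.comp_assoc, LinearMap.trace_comp_comm', ← LinearMap.comp_assoc, hfa,
      LinearMap.comp_assoc, hs, LinearMap.comp_id]
  have h2 : LinearMap.trace k A (a ∘ₗ (LinearMap.id - s ∘ₗ f)) = LinearMap.trace k K c := by
    rw [← hq, ← LinearMap.comp_assoc, hιa, LinearMap.comp_assoc, LinearMap.trace_comp_comm',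
      LinearMap.comp_assoc, hrι, LinearMap.comp_id]
  rw [← h1, ← h2, ← map_add, ← LinearMap.comp_add]
  simp

theorem Representation.isChar {G V : Type} [Group G] [AddCommGroup V] [Module ℂ V]
    [FiniteDimensional ℂ V] (ρ : Representation ℂ G V) : IsChar G ρ.character :=
  ⟨FDRep.of ρ, fun _ => rfl⟩

theorem IsChar.exists_rep {G : Type} [Group G] {χ : G → ℂ} (h : IsChar G χ) :
    ∃ V : FDRep ℂ G, Representation.character V.ρ = χ :=
  let ⟨V, hV⟩ := h
  ⟨V, funext hV⟩

theorem IsChar.add {G : Type} [Group G] {φ ψ : G → ℂ} (hφ : IsChar G φ) (hψ : IsChar G ψ) :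
    IsChar G (φ + ψ) := by
  obtain ⟨V, rfl⟩ := hφ.exists_rep
  obtain ⟨W, rfl⟩ := hψ.exists_rep
  convert Representation.isChar (Representation.prod V.ρ W.ρ) using 1
  ext g
  exact (LinearMap.trace_prodMap' (V.ρ g) (W.ρ g)).symm

theorem IsChar.mul {G : Type} [Group G] {φ ψ : G → ℂ} (hφ : IsChar G φ) (hψ : IsChar G ψ) :
    IsChar G (φ * ψ) := by
  obtain ⟨V, rfl⟩ := hφ.exists_rep
  obtain ⟨W, rfl⟩ := hψ.exists_rep
  rw [← Representation.char_tensor]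
  exact Representation.isChar _

theorem isChar_zero (G : Type) [Group G] : IsChar G 0 := by
  convert Representation.isChar (Representation.trivial ℂ G (Fin 0 → ℂ)) using 1
  ext g
  simp [Representation.character]

theorem isChar_one (G : Type) [Group G] : IsChar G 1 := by
  convert Representation.isChar (Representation.trivial ℂ G ℂ) using 1
  ext g
  simp [Representation.character, Representation.trivial]

theorem IsChar.pow {G : Type} [Group G] {φ : G → ℂ} (hφ : IsChar G φ) (m : ℕ) :
    IsChar G (φ ^ m) := by
  induction m with
  | zero => simpa using isChar_one G
  | succ m ih => simpa [pow_succ] using ih.mul hφ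

/-- Monotonicity of powers for the partial order on characters given by constituents. -/
theorem IsChar.pow_sub_pow {G : Type} [Group G] {φ ψ : G → ℂ} (hψ : IsChar G ψ)
    (h : IsChar G (φ - ψ)) (m : ℕ) : IsChar G (φ ^ m - ψ ^ m) := by
  have hφ : IsChar G φ := by simpa using h.add hψ
  induction m with
  | zero => simpa using isChar_zero G
  | succ m ih =>
    convert (ih.mul hφ).add ((hψ.pow m).mul h) using 1
    ring

theorem IsChar.conj {G : Type} [Group G] {φ : G → ℂ} (hφ : IsChar G φ) :
    IsChar G fun g => (starRingEnd ℂ) (φ g) := by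
  obtain ⟨V, rfl⟩ := hφ.exists_rep
  let b := Module.finBasis ℂ V
  let σ : Representation ℂ G (Fin (Module.finrank ℂ V) → ℂ) :=
    ((Matrix.toLinAlgEquiv' (R := ℂ)).toRingHom.toMonoidHom.comp
      ((starRingEnd ℂ).mapMatrix.toMonoidHom.comp
        (LinearMap.toMatrixAlgEquiv b).toRingHom.toMonoidHom)).comp V.ρ
  convert Representation.isChar σ using 1
  ext g
  have : σ g = Matrix.toLin' ((starRingEnd ℂ).mapMatrix (LinearMap.toMatrix b b (V.ρ g))) := rfl
  rw [Representation.character, Representation.character, this, Matrix.trace_toLin'_eq,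
    LinearMap.trace_eq_matrix_trace ℂ b]
  simp [Matrix.trace]

theorem IsChar.exists_average_eq_natCast {G : Type} [Group G] [Fintype G] {φ : G → ℂ}
    (hφ : IsChar G φ) : ∃ d : ℕ, (Nat.card G : ℂ)⁻¹ * ∑ g, φ g = d := by
  obtain ⟨V, rfl⟩ := hφ.exists_rep
  have : Invertible (Nat.card G : ℂ) := invertibleOfNonzero (by simp)
  exact ⟨_, Representation.card_inv_mul_sum_char_eq_finrank _⟩

theorem IsIrrChar.isChar {G : Type} [Group G] {χ : G → ℂ} (h : IsIrrChar G χ) : IsChar G χ :=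
  let ⟨V, _, hV⟩ := h
  ⟨V, hV⟩

theorem IsIrrChar.exists_apply_one {G : Type} [Group G] [Finite G] {χ : G → ℂ}
    (h : IsIrrChar G χ) : ∃ d : ℕ, 0 < d ∧ χ 1 = d := by
  obtain ⟨V, hV, hχ⟩ := h
  refine ⟨Module.finrank ℂ V, ?_, by rw [← hχ, FDRep.char_one]⟩
  rw [Nat.pos_iff_ne_zero]
  intro h0
  have : Subsingleton V := Module.finrank_zero_iff.1 h0
  refine CategoryTheory.id_nonzero V ?_
  ext x
  exact Subsingleton.elim (α := V) _ _

/-- The character of the regular representation. -/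
noncomputable def regChar (G : Type) [Group G] [DecidableEq G] (g : G) : ℂ :=
  if g = 1 then Nat.card G else 0

/-- If `φ` contains the regular character, then every irreducible character is a constituent of
`φ·χ` for each irreducible character `χ`. -/
theorem charInner_mul_ne_zero {G : Type} [Group G] [Fintype G] [DecidableEq G] {φ χ₁ χ₂ : G → ℂ}
    (hφ : IsChar G (φ - regChar G)) (h₁ : IsIrrChar G χ₁) (h₂ : IsIrrChar G χ₂) :
    charInner (φ * χ₁) χ₂ ≠ 0 := by
  obtain ⟨d, hd⟩ := ((hφ.mul h₁.isChar).mul h₂.isChar.conj).exists_average_eq_natCast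
  obtain ⟨d₁, hd₁, h1⟩ := h₁.exists_apply_one
  obtain ⟨d₂, hd₂, h2⟩ := h₂.exists_apply_one
  have key : charInner (φ * χ₁) χ₂ = (d + d₁ * d₂ : ℕ) := by
    have hsplit : ∀ g, (φ * χ₁) g * (starRingEnd ℂ) (χ₂ g) =
        ((φ - regChar G) * χ₁ * fun g => (starRingEnd ℂ) (χ₂ g)) g +
          if g = 1 then (Nat.card G : ℂ) * (d₁ * d₂) else 0 := by
      intro g
      by_cases hg : g = 1
      · subst hg
        simp [regChar, h1, h2]
        ring
      · simp [regChar, hg]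
    rw [charInner, finsum_eq_sum_of_fintype, Finset.sum_congr rfl fun g _ => hsplit g,
      Finset.sum_add_distrib, mul_add, hd]
    simp
  rw [key, Nat.cast_ne_zero]
  positivity

/-- The kernel of a surjective equivariant map affords the difference of characters. -/
theorem isChar_sub_of_surjective {G A B : Type} [Group G] [AddCommGroup A] [Module ℂ A]
    [FiniteDimensional ℂ A] [AddCommGroup B] [Module ℂ B] [FiniteDimensional ℂ B]
    (ρ : Representation ℂ G A) (σ : Representation ℂ G B) (f : A →ₗ[ℂ] B)
    (hf : Function.Surjective f) (hfρ : ∀ g, f ∘ₗ ρ g = σ g ∘ₗ f) :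
    IsChar G (ρ.character - σ.character) := by
  have hle : ∀ g, LinearMap.ker f ≤ (LinearMap.ker f).comap (ρ g) := by
    intro g x hx
    have hgx : f (ρ g x) = σ g (f x) := LinearMap.congr_fun (hfρ g) x
    rw [Submodule.mem_comap, LinearMap.mem_ker, hgx, LinearMap.mem_ker.1 hx, map_zero]
  convert Representation.isChar (ρ.subrepresentation _ hle) using 1
  ext g
  rw [Pi.sub_apply, sub_eq_iff_eq_add']
  exact LinearMap.trace_eq_add_of_exact (LinearMap.ker f).subtype f
    (Submodule.injective_subtype _) hf (Submodule.range_subtype _) _ _ _ (hfρ g) rfl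

/-! ### Permutation representations -/

/-- The permutation representation on functions on a `G`-set. -/
def permRep (G X : Type) [Group G] [MulAction G X] : Representation ℂ G (X → ℂ) where
  toFun g := LinearMap.funLeft ℂ ℂ fun x => g⁻¹ • x
  map_one' := by ext; simp
  map_mul' g h := by
    apply LinearMap.ext
    intro f
    ext x
    simp [LinearMap.funLeft, mul_smul]

@[simp]
theorem permRep_apply {G X : Type} [Group G] [MulAction G X] (g : G) (f : X → ℂ) (x : X) :
    permRep G X g f x = f (g⁻¹ • x) := rfl

theorem permRep_character {G X : Type} [Group G] [MulAction G X] [Fintype X] [DecidableEq X]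
    (g : G) : (permRep G X).character g = (Finset.univ.filter fun x : X => g • x = x).card := by
  rw [Representation.character, LinearMap.trace_eq_matrix_trace ℂ (Pi.basisFun ℂ X),
    Matrix.trace]
  simp only [Matrix.diag_apply, LinearMap.toMatrix_apply, Pi.basisFun_repr, Pi.basisFun_apply,
    permRep_apply, Pi.single_apply, Finset.sum_boole]
  congr 2
  ext x
  simp only [Finset.mem_filter_univ, inv_smul_eq_iff]
  exact eq_comm

/-- A permutation character contains the regular character as soon as some orbit is regular. -/
theorem isChar_permRep_sub_regChar {G X : Type} [Group G] [Fintype G] [DecidableEq G]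
    [MulAction G X] [Fintype X] [DecidableEq X] (t : X)
    (ht : Function.Injective fun g : G => g • t) :
    IsChar G ((permRep G X).character - regChar G) := by
  have hreg : (permRep G G).character = regChar G := by
    ext g
    rw [permRep_character, regChar]
    by_cases hg : g = 1 <;> simp [hg]
  rw [← hreg]
  refine isChar_sub_of_surjective _ _ (LinearMap.funLeft ℂ ℂ fun g : G => g • t)
    (LinearMap.funLeft_surjective_of_injective _ _ _ ht) fun g => ?_
  apply LinearMap.ext
  intro f
  ext h
  simp [LinearMap.funLeft, mul_smul]

/-! ### The representation on pairs -/

/-- The two-element subsets of `Fin n`. -/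
abbrev Pair (n : ℕ) : Type := {s : Finset (Fin n) // s.card = 2}

instance Pair.instMulAction (n : ℕ) : MulAction (Equiv.Perm (Fin n)) (Pair n) where
  smul g s := ⟨s.1.image fun x => g x, by rw [Finset.card_image_of_injective _ g.injective, s.2]⟩
  one_smul s := Subtype.ext (by ext; simp [HSMul.hSMul])
  mul_smul g h s := Subtype.ext (by ext; simp [HSMul.hSMul])

theorem Pair.coe_smul {n : ℕ} (g : Equiv.Perm (Fin n)) (s : Pair n) :
    ((g • s : Pair n) : Finset (Fin n)) = s.1.image fun x => g x := rfl

/-- A function on pairs, viewed as a symmetric matrix with zero diagonal. -/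
def pairMatrix (n : ℕ) : (Pair n → ℂ) →ₗ[ℂ] Fin n → Fin n → ℂ where
  toFun f x y := if h : x ≠ y then f ⟨{x, y}, Finset.card_pair h⟩ else 0
  map_add' f g := by
    ext x y
    by_cases h : x = y <;> simp [h]
  map_smul' c f := by
    ext x y
    by_cases h : x = y <;> simp [h]

section pairMatrix

variable {n : ℕ}

theorem pairMatrix_of_ne (f : Pair n → ℂ) {x y : Fin n} (h : x ≠ y) :
    pairMatrix n f x y = f ⟨{x, y}, Finset.card_pair h⟩ := dif_pos h

@[simp]
theorem pairMatrix_self (f : Pair n → ℂ) (x : Fin n) : pairMatrix n f x x = 0 := by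
  simp [pairMatrix]

theorem pairMatrix_comm (f : Pair n → ℂ) (x y : Fin n) :
    pairMatrix n f x y = pairMatrix n f y x := by
  rcases eq_or_ne x y with rfl | h
  · rfl
  · rw [pairMatrix_of_ne f h, pairMatrix_of_ne f h.symm]
    congr 2
    exact Finset.pair_comm x y

theorem pairMatrix_injective : Function.Injective (pairMatrix n) := by
  intro f g h
  ext ⟨s, hs⟩
  obtain ⟨x, y, hxy, rfl⟩ := Finset.card_eq_two.1 hs
  rw [← pairMatrix_of_ne f hxy, ← pairMatrix_of_ne g hxy, h]

theorem pairMatrix_permRep (g : Equiv.Perm (Fin n)) (f : Pair n → ℂ) (x y : Fin n) :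
    pairMatrix n (permRep _ _ g f) x y = pairMatrix n f (g⁻¹ x) (g⁻¹ y) := by
  rcases eq_or_ne x y with rfl | h
  · simp
  · rw [pairMatrix_of_ne _ h, pairMatrix_of_ne _ (g⁻¹.injective.ne h), permRep_apply]
    congr 1
    apply Subtype.ext
    simp [Pair.coe_smul, Finset.image_insert]

/-- The map sending a symmetric matrix with zero diagonal to its vector of row sums. -/
def rowSum (n : ℕ) : (Pair n → ℂ) →ₗ[ℂ] Fin n → ℂ where
  toFun f x := ∑ y, pairMatrix n f x y
  map_add' f g := by
    ext x
    simp [Finset.sum_add_distrib]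
  map_smul' c f := by
    ext x
    simp [Finset.mul_sum]

theorem rowSum_apply (f : Pair n → ℂ) (x : Fin n) : rowSum n f x = ∑ y, pairMatrix n f x y := rfl

theorem rowSum_permRep (g : Equiv.Perm (Fin n)) :
    rowSum n ∘ₗ permRep _ _ g = permRep _ _ g ∘ₗ rowSum n := by
  apply LinearMap.ext
  intro f
  ext x
  simp only [LinearMap.comp_apply, rowSum_apply, pairMatrix_permRep, permRep_apply]
  exact Equiv.sum_comp g⁻¹ fun y => pairMatrix n f (g⁻¹ x) y

/-- The symmetrised product of two vectors with disjoint supports, as a function on pairs. -/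
def symProd (v w : Fin n → ℂ) (s : Pair n) : ℂ := (∑ i ∈ s.1, v i) * ∑ i ∈ s.1, w i

theorem pairMatrix_symProd {v w : Fin n → ℂ} (h : ∀ i, v i * w i = 0) (x y : Fin n) :
    pairMatrix n (symProd v w) x y = v x * w y + v y * w x := by
  rcases eq_or_ne x y with rfl | hxy
  · simp [h]
  · rw [pairMatrix_of_ne _ hxy, symProd, Finset.sum_pair hxy, Finset.sum_pair hxy]
    linear_combination h x + h y

theorem rowSum_symProd {v w : Fin n → ℂ} (h : ∀ i, v i * w i = 0) (x : Fin n) :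
    rowSum n (symProd v w) x = v x * ∑ y, w y + w x * ∑ y, v y := by
  simp_rw [rowSum_apply, pairMatrix_symProd h, Finset.sum_add_distrib, ← Finset.sum_mul,
    ← Finset.mul_sum]
  ring

/-- The signed 4-cycle `a — c — b — d — a`, as a function on pairs. -/
def fourCycle (a b c d : Fin n) : Pair n → ℂ :=
  symProd (Pi.single a 1 - Pi.single b 1) (Pi.single c 1 - Pi.single d 1)

theorem single_sub_single_mul_eq_zero {a b c d : Fin n} (hac : a ≠ c) (had : a ≠ d) (hbc : b ≠ c)
    (hbd : b ≠ d) (i : Fin n) : (Pi.single a 1 - Pi.single b 1 : Fin n → ℂ) i *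
      (Pi.single c 1 - Pi.single d 1 : Fin n → ℂ) i = 0 := by
  simp only [Pi.sub_apply, Pi.single_apply]
  split_ifs <;> simp_all

theorem rowSum_fourCycle {a b c d : Fin n} (hac : a ≠ c) (had : a ≠ d) (hbc : b ≠ c)
    (hbd : b ≠ d) : rowSum n (fourCycle a b c d) = 0 := by
  ext x
  rw [fourCycle, rowSum_symProd (single_sub_single_mul_eq_zero hac had hbc hbd)]
  simp

theorem pairMatrix_fourCycle {a b c d : Fin n} (hac : a ≠ c) (had : a ≠ d) (hbc : b ≠ c)
    (hbd : b ≠ d) (x y : Fin n) : pairMatrix n (fourCycle a b c d) x y =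
      ((if x = a then 1 else 0) - (if x = b then 1 else 0)) *
        ((if y = c then 1 else 0) - (if y = d then 1 else 0)) +
      ((if y = a then 1 else 0) - (if y = b then 1 else 0)) *
        ((if x = c then 1 else 0) - (if x = d then 1 else 0)) := by
  rw [fourCycle, pairMatrix_symProd (single_sub_single_mul_eq_zero hac had hbc hbd)]
  simp only [Pi.sub_apply, Pi.single_apply]

theorem permRep_fourCycle (g : Equiv.Perm (Fin n)) {a b c d : Fin n} (hac : a ≠ c) (had : a ≠ d)
    (hbc : b ≠ c) (hbd : b ≠ d) :
    permRep _ _ g (fourCycle a b c d) = fourCycle (g a) (g b) (g c) (g d) := by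
  apply pairMatrix_injective
  ext x y
  rw [pairMatrix_permRep, pairMatrix_fourCycle hac had hbc hbd, pairMatrix_fourCycle
    (g.injective.ne hac) (g.injective.ne had) (g.injective.ne hbc) (g.injective.ne hbd)]
  simp only [Equiv.Perm.inv_eq_iff_eq]

/-- The coefficient of `f` along the signed 4-cycle `a — c — b — d — a`. -/
def cycleCoeff (f : Pair n → ℂ) (a b c d : Fin n) : ℂ :=
  pairMatrix n f a c - pairMatrix n f b c - pairMatrix n f a d + pairMatrix n f b d

theorem alternating_swaps (f : Pair n → ℂ) {a b c d : Fin n} (hab : a ≠ b) (hac : a ≠ c)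
    (had : a ≠ d) (hbc : b ≠ c) (hbd : b ≠ d) (hcd : c ≠ d) :
    f - permRep _ _ (Equiv.swap a b) f - permRep _ _ (Equiv.swap c d) f +
      permRep _ _ (Equiv.swap c d) (permRep _ _ (Equiv.swap a b) f) =
        cycleCoeff f a b c d • fourCycle a b c d := by
  apply pairMatrix_injective
  ext x y
  simp only [map_add, map_sub, map_smul, Pi.add_apply, Pi.sub_apply, Pi.smul_apply,
    pairMatrix_permRep, Equiv.swap_inv, pairMatrix_fourCycle hac had hbc hbd, smul_eq_mul,
    cycleCoeff]
  have hsymm := pairMatrix_comm f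
  have hdiag := pairMatrix_self f
  generalize pairMatrix n f = M at hsymm hdiag ⊢
  have hcases : ∀ x, x = a ∨ x = b ∨ x = c ∨ x = d ∨ (x ≠ a ∧ x ≠ b ∧ x ≠ c ∧ x ≠ d) := by
    intro x
    tauto
  rcases hcases x with rfl | rfl | rfl | rfl | ⟨hxa, hxb, hxc, hxd⟩ <;>
  rcases hcases y with rfl | rfl | rfl | rfl | ⟨hya, hyb, hyc, hyd⟩ <;>
  simp_all [Equiv.swap_apply_of_ne_of_ne, Ne.symm] <;> grind

theorem eq_zero_of_cycleCoeff_eq_zero (hn : 4 ≤ n) {f : Pair n → ℂ} (hf : rowSum n f = 0)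
    (h : ∀ a b c d : Fin n, a ≠ b → a ≠ c → a ≠ d → b ≠ c → b ≠ d → c ≠ d →
      cycleCoeff f a b c d = 0) : f = 0 := by
  have hrow : ∀ x, ∑ y, pairMatrix n f x y = 0 := congrFun hf
  have hdiff : ∀ a b c, a ≠ b → a ≠ c → b ≠ c → pairMatrix n f a c = pairMatrix n f b c := by
    intro a b c hab hac hbc
    have hconst : ∀ d, pairMatrix n f a d - pairMatrix n f b d =
        (pairMatrix n f a c - pairMatrix n f b c) *
          (1 - (if d = a then 1 else 0) - (if d = b then 1 else 0)) +
        (if d = a then - pairMatrix n f a b else 0) + (if d = b then pairMatrix n f a b else 0) := by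
      intro d
      rcases eq_or_ne d a with rfl | hda
      · simp [hab, pairMatrix_comm f b]
      rcases eq_or_ne d b with rfl | hdb
      · simp [hda]
      rcases eq_or_ne d c with rfl | hdc
      · simp [hda, hdb]
      have := h a b c d hab hac hda.symm hbc hdb.symm hdc.symm
      rw [cycleCoeff] at this
      simp only [hda, hdb, if_false]
      linear_combination -this
    have hsum := Finset.sum_congr rfl fun d (_ : d ∈ Finset.univ) => hconst d
    rw [Finset.sum_sub_distrib, hrow, hrow] at hsum
    simp only [Finset.sum_add_distrib, ← Finset.mul_sum, Finset.sum_sub_distrib,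
      Finset.sum_ite_eq', Finset.mem_univ, if_true, Finset.sum_const, Finset.card_univ,
      Fintype.card_fin, nsmul_eq_mul] at hsum
    have hn' : (n : ℂ) - 2 ≠ 0 := by
      rw [sub_ne_zero]
      exact_mod_cast (by omega : n ≠ 2)
    refine sub_eq_zero.1 ((mul_eq_zero.1 ?_).resolve_right hn')
    linear_combination -hsum
  apply pairMatrix_injective
  ext x y
  rw [map_zero]
  rcases eq_or_ne x y with rfl | hxy
  · simp
  have hconst : ∀ z, pairMatrix n f z y = pairMatrix n f x y * (1 - if z = y then 1 else 0) := by
    intro z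
    rcases eq_or_ne z y with rfl | hzy
    · simp
    rcases eq_or_ne z x with rfl | hzx
    · simp [hzy]
    · simp [hzy, hdiff z x y hzx hzy hxy]
  have hsum := Finset.sum_congr rfl fun z (_ : z ∈ Finset.univ) => hconst z
  simp_rw [pairMatrix_comm f _ y] at hsum
  rw [hrow, ← Finset.mul_sum, Finset.sum_sub_distrib] at hsum
  simp only [Finset.sum_ite_eq', Finset.mem_univ, if_true, Finset.sum_const, Finset.card_univ,
      Fintype.card_fin, nsmul_eq_mul] at hsum
  have hn' : (n : ℂ) - 1 ≠ 0 := by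
    rw [sub_ne_zero]
    exact_mod_cast (by omega : n ≠ 1)
  rw [pairMatrix_comm]
  refine (mul_eq_zero.1 ?_).resolve_right hn'
  linear_combination -hsum

theorem exists_notMem_of_card_lt {m : ℕ} (s : Finset (Fin m)) (h : s.card < m) : ∃ x, x ∉ s := by
  by_contra! hs
  have := Finset.card_le_card (fun x _ => hs x : Finset.univ ⊆ s)
  simp at this
  omega

theorem exists_four_distinct (hn : 4 ≤ n) (a : Fin n) :
    ∃ b c d : Fin n, a ≠ b ∧ a ≠ c ∧ a ≠ d ∧ b ≠ c ∧ b ≠ d ∧ c ≠ d := by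
  obtain ⟨b, hb⟩ := exists_notMem_of_card_lt {a} (by simp; omega)
  obtain ⟨c, hc⟩ := exists_notMem_of_card_lt {a, b} (Finset.card_le_two.trans_lt (by omega))
  obtain ⟨d, hd⟩ := exists_notMem_of_card_lt {a, b, c} (Finset.card_le_three.trans_lt (by omega))
  exact ⟨b, c, d, by grind, by grind, by grind, by grind, by grind, by grind⟩

theorem eq_top_of_single_mem {p : Submodule ℂ (Fin n → ℂ)} (h : ∀ a, Pi.single a 1 ∈ p) :
    p = ⊤ := by
  rw [eq_top_iff, ← (Pi.basisFun ℂ (Fin n)).span_eq, Submodule.span_le]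
  rintro _ ⟨a, rfl⟩
  simpa using h a

theorem rowSum_surjective (hn : 4 ≤ n) : Function.Surjective (rowSum n) := by
  rw [← LinearMap.range_eq_top]
  apply eq_top_of_single_mem
  intro a
  obtain ⟨b, c, -, hab, hac, -, hbc, -, -⟩ := exists_four_distinct hn a
  have hmem : ∀ x y : Fin n, x ≠ y →
      (Pi.single x 1 + Pi.single y 1 : Fin n → ℂ) ∈ LinearMap.range (rowSum n) := by
    intro x y hxy
    refine ⟨symProd (Pi.single x 1) (Pi.single y 1), ?_⟩
    ext i
    rw [rowSum_symProd]
    · simp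
    · intro i
      simp only [Pi.single_apply]
      split_ifs <;> simp_all
  convert Submodule.smul_mem _ (1 / 2 : ℂ)
    (Submodule.sub_mem _ (Submodule.add_mem _ (hmem a b hab) (hmem a c hac)) (hmem b c hbc)) using 1
  module

theorem rowSum_permRep_apply (g : Equiv.Perm (Fin n)) (f : Pair n → ℂ) :
    rowSum n (permRep _ _ g f) = permRep _ _ g (rowSum n f) :=
  LinearMap.congr_fun (rowSum_permRep g) f

/-- The representation of the symmetric group on the kernel of the row sum map. -/
def pairRep (n : ℕ) : Representation ℂ (Equiv.Perm (Fin n)) (LinearMap.ker (rowSum n)) :=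
  (permRep _ _).subrepresentation _ fun g f hf => by
    rw [Submodule.mem_comap, LinearMap.mem_ker, rowSum_permRep_apply, LinearMap.mem_ker.1 hf,
      map_zero]

@[simp]
theorem coe_pairRep_apply (g : Equiv.Perm (Fin n)) (f : LinearMap.ker (rowSum n)) :
    (pairRep n g f : Pair n → ℂ) = permRep _ _ g f.1 := rfl

theorem pairRep_character (hn : 4 ≤ n) : (pairRep n).character =
    (permRep _ (Pair n)).character - (permRep (Equiv.Perm (Fin n)) (Fin n)).character := by
  ext g
  rw [Pi.sub_apply, eq_sub_iff_add_eq']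
  exact (LinearMap.trace_eq_add_of_exact (LinearMap.ker (rowSum n)).subtype (rowSum n)
    (Submodule.injective_subtype _) (rowSum_surjective hn) (Submodule.range_subtype _) _ _ _
    (rowSum_permRep g) rfl).symm

theorem exists_perm_apply_eq {a b c d a' b' c' d' : Fin n} (hab : a ≠ b) (hac : a ≠ c)
    (had : a ≠ d) (hbc : b ≠ c) (hbd : b ≠ d) (hcd : c ≠ d) (hab' : a' ≠ b') (hac' : a' ≠ c')
    (had' : a' ≠ d') (hbc' : b' ≠ c') (hbd' : b' ≠ d') (hcd' : c' ≠ d') :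
    ∃ g : Equiv.Perm (Fin n), g a = a' ∧ g b = b' ∧ g c = c' ∧ g d = d' := by
  have hinj : ∀ {p q r s : Fin n}, p ≠ q → p ≠ r → p ≠ s → q ≠ r → q ≠ s → r ≠ s →
      Function.Injective ![p, q, r, s] := by
    intro p q r s h1 h2 h3 h4 h5 h6 i j hij
    fin_cases i <;> fin_cases j <;> simp_all
  have := Equiv.Perm.isMultiplyPretransitive (Fin n) 4
  obtain ⟨g, hg⟩ := MulAction.exists_smul_eq (Equiv.Perm (Fin n))
    (⟨_, hinj hab hac had hbc hbd hcd⟩ : Fin 4 ↪ Fin n)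
    (⟨_, hinj hab' hac' had' hbc' hbd' hcd'⟩ : Fin 4 ↪ Fin n)
  exact ⟨g, DFunLike.congr_fun hg 0, DFunLike.congr_fun hg 1, DFunLike.congr_fun hg 2,
    DFunLike.congr_fun hg 3⟩

/-- The signed 4-cycle as a vector of `pairRep`. -/
def fourCycleKer (a b c d : Fin n) (hac : a ≠ c) (had : a ≠ d) (hbc : b ≠ c) (hbd : b ≠ d) :
    LinearMap.ker (rowSum n) :=
  ⟨fourCycle a b c d, rowSum_fourCycle hac had hbc hbd⟩

theorem equivariant_cycleCoeff_smul {T : LinearMap.ker (rowSum n) →ₗ[ℂ] LinearMap.ker (rowSum n)}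
    (hT : ∀ g f, T (pairRep n g f) = pairRep n g (T f)) {a b c d : Fin n} (hab : a ≠ b)
    (hac : a ≠ c) (had : a ≠ d) (hbc : b ≠ c) (hbd : b ≠ d) (hcd : c ≠ d)
    (f : LinearMap.ker (rowSum n)) :
    cycleCoeff (T f).1 a b c d • fourCycleKer a b c d hac had hbc hbd =
      cycleCoeff f.1 a b c d • T (fourCycleKer a b c d hac had hbc hbd) := by
  have hswap : ∀ h : LinearMap.ker (rowSum n),
      h - pairRep n (Equiv.swap a b) h - pairRep n (Equiv.swap c d) h +
        pairRep n (Equiv.swap c d) (pairRep n (Equiv.swap a b) h) =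
      cycleCoeff h.1 a b c d • fourCycleKer a b c d hac had hbc hbd :=
    fun h => Subtype.ext (alternating_swaps h.1 hab hac had hbc hbd hcd)
  rw [← hswap, ← map_smul, ← hswap]
  simp only [map_add, map_sub, hT]

theorem exists_smul_of_equivariant (hn : 4 ≤ n)
    (T : LinearMap.ker (rowSum n) →ₗ[ℂ] LinearMap.ker (rowSum n))
    (hT : ∀ g f, T (pairRep n g f) = pairRep n g (T f)) :
    ∃ μ : ℂ, ∀ f, T f = μ • f := by
  obtain ⟨b, c, d, hab, hac, had, hbc, hbd, hcd⟩ := exists_four_distinct hn ⟨0, by omega⟩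
  generalize (⟨0, _⟩ : Fin n) = a at hab hac had
  let z := fourCycleKer a b c d hac had hbc hbd
  have hz : cycleCoeff z.1 a b c d = 4 := by
    simp only [z, fourCycleKer, cycleCoeff, pairMatrix_fourCycle hac had hbc hbd]
    simp [hab, hac, had, hbc, hbd, hcd, hab.symm, hac.symm, had.symm, hbc.symm, hbd.symm,
      hcd.symm]
    norm_num
  let μ := cycleCoeff (T z).1 a b c d / 4
  have hTz : T z = μ • z := by
    have := equivariant_cycleCoeff_smul hT hab hac had hbc hbd hcd z
    rw [hz] at this
    rw [show μ = 4⁻¹ * cycleCoeff (T z).1 a b c d from div_eq_inv_mul _ _, mul_smul, this,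
      smul_smul]
    norm_num
    rfl
  refine ⟨μ, fun f => ?_⟩
  let S := T - μ • LinearMap.id
  have hS : ∀ g f, S (pairRep n g f) = pairRep n g (S f) := by
    intro g f
    simp [S, hT]
  suffices S f = 0 from sub_eq_zero.1 this
  apply Subtype.ext
  refine eq_zero_of_cycleCoeff_eq_zero hn (S f).2 fun p q r s hpq hpr hps hqr hqs hrs => ?_
  obtain ⟨g, rfl, rfl, rfl, rfl⟩ :=
    exists_perm_apply_eq hab hac had hbc hbd hcd hpq hpr hps hqr hqs hrs
  have hgz : fourCycleKer (g a) (g b) (g c) (g d) hpr hps hqr hqs = pairRep n g z :=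
    Subtype.ext (permRep_fourCycle g hac had hbc hbd).symm
  have hkill : S (pairRep n g z) = 0 := by
    rw [hS]
    simp [S, hTz]
  have hcoeff := equivariant_cycleCoeff_smul hS hpq hpr hps hqr hqs hrs f
  rw [hgz, hkill, smul_zero, smul_eq_zero] at hcoeff
  refine hcoeff.resolve_right fun h0 => ?_
  have hz0 : z = 0 := by
    rw [← (pairRep n).inv_self_apply g z, h0, map_zero]
  rw [hz0] at hz
  simp [cycleCoeff] at hz

theorem simple_pairRep (hn : 4 ≤ n) : CategoryTheory.Simple (FDRep.of (pairRep n)) := by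
  rw [FDRep.simple_iff_end_is_rank_one]
  refine finrank_eq_one (CategoryTheory.CategoryStruct.id _) ?_ ?_
  · intro h
    obtain ⟨b, c, d, hab, hac, had, hbc, hbd, hcd⟩ := exists_four_distinct hn ⟨0, by omega⟩
    generalize (⟨0, _⟩ : Fin n) = a at hab hac had
    have hz : fourCycleKer a b c d hac had hbc hbd = 0 :=
      congrArg (fun φ : FDRep.of (pairRep n) ⟶ FDRep.of (pairRep n) =>
        φ.hom.hom.hom (fourCycleKer a b c d hac had hbc hbd)) h
    have := pairMatrix_fourCycle hac had hbc hbd a c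
    rw [show fourCycle a b c d = 0 from congrArg Subtype.val hz] at this
    simp [hab, hac, had, hcd, hac.symm, hbc.symm] at this
  · intro φ
    obtain ⟨μ, hμ⟩ := exists_smul_of_equivariant hn φ.hom.hom.hom fun g f =>
      LinearMap.congr_fun (congrArg (fun ψ => ψ.hom.hom) (φ.comm g)) f
    refine ⟨μ, ?_⟩
    ext f
    exact congrFun (congrArg Subtype.val (hμ f).symm) _

/-- The equivariant map sending `f ⊗ h` to the row sums of the entrywise product. -/
noncomputable def rowSumMul (n : ℕ) :
    TensorProduct ℂ (LinearMap.ker (rowSum n)) (LinearMap.ker (rowSum n)) →ₗ[ℂ] Fin n → ℂ :=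
  TensorProduct.lift <| LinearMap.mk₂ ℂ
    (fun f h x => ∑ y, pairMatrix n f.1 x y * pairMatrix n h.1 x y)
    (fun _ _ _ => by ext; simp [add_mul, Finset.sum_add_distrib])
    (fun _ _ _ => by ext; simp [mul_assoc, Finset.mul_sum])
    (fun _ _ _ => by ext; simp [mul_add, Finset.sum_add_distrib])
    (fun _ _ _ => by ext; simp [mul_left_comm, Finset.mul_sum])

theorem rowSumMul_tmul (f h : LinearMap.ker (rowSum n)) (x : Fin n) :
    rowSumMul n (f ⊗ₜ[ℂ] h) x = ∑ y, pairMatrix n f.1 x y * pairMatrix n h.1 x y := rfl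

theorem rowSumMul_tprod (g : Equiv.Perm (Fin n)) :
    rowSumMul n ∘ₗ (pairRep n).tprod (pairRep n) g = permRep _ _ g ∘ₗ rowSumMul n := by
  apply TensorProduct.ext'
  intro f h
  ext x
  simp only [LinearMap.comp_apply, Representation.tprod_apply, TensorProduct.map_tmul,
    rowSumMul_tmul, coe_pairRep_apply, pairMatrix_permRep, permRep_apply]
  exact Equiv.sum_comp g⁻¹ fun y => pairMatrix n f.1 (g⁻¹ x) y * pairMatrix n h.1 (g⁻¹ x) y

theorem rowSumMul_surjective (hn : 5 ≤ n) : Function.Surjective (rowSumMul n) := by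
  rw [← LinearMap.range_eq_top]
  have hmem : ∀ {a b c d : Fin n}, a ≠ b → a ≠ c → a ≠ d → b ≠ c → b ≠ d → c ≠ d →
      (Pi.single a 1 + Pi.single b 1 + Pi.single c 1 + Pi.single d 1 : Fin n → ℂ) ∈
        LinearMap.range (rowSumMul n) := by
    intro a b c d hab hac had hbc hbd hcd
    refine ⟨(1 / 2 : ℂ) • (fourCycleKer a b c d hac had hbc hbd ⊗ₜ
      fourCycleKer a b c d hac had hbc hbd), ?_⟩
    ext x
    rw [map_smul, Pi.smul_apply, rowSumMul_tmul]
    have hsq : ∀ y, pairMatrix n (fourCycle a b c d) x y * pairMatrix n (fourCycle a b c d) x y =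
        ((if x = a then 1 else 0) + (if x = b then 1 else 0)) *
          ((if y = c then 1 else 0) + (if y = d then 1 else 0)) +
        ((if x = c then 1 else 0) + (if x = d then 1 else 0)) *
          ((if y = a then 1 else 0) + (if y = b then 1 else 0)) := by
      intro y
      rw [pairMatrix_fourCycle hac had hbc hbd]
      have hx : x = a ∨ x = b ∨ x = c ∨ x = d ∨ (x ≠ a ∧ x ≠ b ∧ x ≠ c ∧ x ≠ d) := by tauto
      rcases hx with rfl | rfl | rfl | rfl | ⟨hxa, hxb, hxc, hxd⟩ <;>
        simp only [*, if_true, if_false] <;> grind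
    simp only [fourCycleKer, hsq, Finset.sum_add_distrib, ← Finset.mul_sum, Finset.sum_ite_eq',
      Finset.mem_univ, if_true, Pi.add_apply, Pi.single_apply, smul_eq_mul]
    ring
  have hsub : ∀ a b : Fin n, a ≠ b →
      (Pi.single a 1 - Pi.single b 1 : Fin n → ℂ) ∈ LinearMap.range (rowSumMul n) := by
    intro a b hab
    obtain ⟨c, hc⟩ := exists_notMem_of_card_lt {a, b} (Finset.card_le_two.trans_lt (by omega))
    obtain ⟨d, hd⟩ := exists_notMem_of_card_lt {a, b, c} (Finset.card_le_three.trans_lt (by omega))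
    obtain ⟨e, he⟩ := exists_notMem_of_card_lt {a, b, c, d} (Finset.card_le_four.trans_lt hn)
    simp only [Finset.mem_insert, Finset.mem_singleton, not_or] at hc hd he
    convert Submodule.sub_mem _
      (hmem (Ne.symm hc.1) (Ne.symm hd.1) (Ne.symm he.1) (Ne.symm hd.2.2) (Ne.symm he.2.2.1)
        (Ne.symm he.2.2.2))
      (hmem (Ne.symm hc.2) (Ne.symm hd.2.1) (Ne.symm he.2.1) (Ne.symm hd.2.2) (Ne.symm he.2.2.1)
        (Ne.symm he.2.2.2)) using 1
    abel
  apply eq_top_of_single_mem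
  intro a
  obtain ⟨b, c, d, hab, hac, had, hbc, hbd, hcd⟩ := exists_four_distinct (by omega) a
  convert Submodule.smul_mem _ (1 / 4 : ℂ) (Submodule.add_mem _ (hmem hab hac had hbc hbd hcd)
    (Submodule.add_mem _ (hsub a b hab) (Submodule.add_mem _ (hsub a c hac) (hsub a d had))))
    using 1
  module

end pairMatrix

theorem isChar_permRep_pow_sub_regChar (m : ℕ) : IsChar (Equiv.Perm (Fin (m + 1)))
    ((permRep (Equiv.Perm (Fin (m + 1))) (Fin (m + 1))).character ^ m - regChar _) := by
  have hpow : (permRep (Equiv.Perm (Fin (m + 1))) (Fin (m + 1))).character ^ m =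
      (permRep (Equiv.Perm (Fin (m + 1))) (Fin m → Fin (m + 1))).character := by
    ext g
    rw [Pi.pow_apply, permRep_character, permRep_character, ← Nat.cast_pow,
      ← Fintype.card_piFinset_const]
    congr 2
    ext t
    simp [funext_iff]
  rw [hpow]
  refine isChar_permRep_sub_regChar Fin.castSucc fun g h hgh => ?_
  have hcast : ∀ i : Fin m, g i.castSucc = h i.castSucc := congrFun hgh
  have hlast : ∀ x, x ≠ Fin.last m → (h⁻¹ * g) x = x := by
    intro x hx
    obtain ⟨i, rfl⟩ := Fin.exists_castSucc_eq.2 hx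
    simp [hcast]
  have hone : h⁻¹ * g = 1 := by
    ext x : 1
    rcases eq_or_ne x (Fin.last m) with rfl | hx
    · by_contra hne
      exact hne ((h⁻¹ * g).injective (hlast _ hne))
    · exact hlast x hx
  exact (inv_mul_eq_one.1 hone).symm

theorem permRep_pair_character {n : ℕ} (g : Equiv.Perm (Fin n)) :
    (permRep (Equiv.Perm (Fin n)) (Pair n)).character g = ((Finset.univ.filter
      fun s : Finset (Fin n) => s.card = 2 ∧ s.image (fun x => g x) = s).card : ℂ) := by
  rw [permRep_character, ← Finset.card_map (Function.Embedding.subtype _)]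
  congr 2
  ext s
  simp [Subtype.ext_iff, Pair.coe_smul, and_comm]

/-- **Step 2 for `χ^{(n−2,2)}`.** For `n ≥ 5` and `G = S_n`, with `π₁` the permutation
character of the natural action on points and `π₂` that of the action on 2-element subsets,
the class function `α = π₂ − π₁` is an irreducible character of `G` (namely `χ^{(n−2,2)}`)
and `diam M(G,α) ≤ 2n − 2`. -/
theorem mckay_diam_chi_n_minus_2_2 (n : ℕ) (hn : 5 ≤ n)
    (π₁ π₂ α : Equiv.Perm (Fin n) → ℂ)
    (hπ₁ : π₁ = fun g => ((Finset.univ.filter fun x : Fin n => g x = x).card : ℂ))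
    (hπ₂ : π₂ = fun g =>
      ((Finset.univ.filter fun s : Finset (Fin n) => s.card = 2 ∧ s.image (fun x => g x) = s).card : ℂ))
    (hα : α = π₂ - π₁) :
    IsIrrChar (Equiv.Perm (Fin n)) α ∧ McKayDiamLE (Equiv.Perm (Fin n)) α (2 * n - 2) := by
  have hpt : π₁ = (permRep (Equiv.Perm (Fin n)) (Fin n)).character := by
    ext g
    rw [hπ₁, permRep_character]
    rfl
  have hpair : π₂ = (permRep (Equiv.Perm (Fin n)) (Pair n)).character := by
    ext g
    rw [hπ₂, permRep_pair_character]
  have hchar : (pairRep n).character = α := by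
    rw [hα, hpt, hpair, pairRep_character (by omega)]
  refine ⟨⟨FDRep.of (pairRep n), simple_pairRep (by omega), congrFun hchar⟩, ?_⟩
  intro χ₁ χ₂ h₁ h₂
  refine ⟨2 * n - 2, le_rfl, charInner_mul_ne_zero ?_ h₁ h₂⟩
  have hsq : IsChar _ (α ^ 2 - π₁) := by
    rw [pow_two, ← hchar, ← Representation.char_tensor, hpt]
    exact isChar_sub_of_surjective _ _ (rowSumMul n) (rowSumMul_surjective hn) rowSumMul_tprod
  obtain ⟨m, rfl⟩ : ∃ m, n = m + 1 := ⟨n - 1, by omega⟩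
  have hle := IsChar.pow_sub_pow (hpt ▸ Representation.isChar _) hsq m
  rw [← pow_mul, show 2 * m = 2 * (m + 1) - 2 by omega] at hle
  simpa [hpt] using hle.add (isChar_permRep_pow_sub_regChar m)
end

section
/- Let n ≥ 3, G = S_n, and let K ≤ G be the centralizer in G of the transposition (n−1, n) (so K ≅ S_{n−2} × S_2). Then for every faithful irreducible character α of G, the restriction of α to K is reducible; that is, [α|_K, α|_K]_K ≥ 2. -/
open scoped BigOperators

open scoped ComplexOrder

/-- The number of self-intertwiners of a representation of a finite group is at most the norm
of its character. -/
theorem finrank_intertwiningMap_le_charInner {G V : Type} [Group G] [Finite G] [AddCommGroup V]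
    [Module ℂ V] [FiniteDimensional ℂ V] (ρ : Representation ℂ G V) :
    (Module.finrank ℂ (Representation.IntertwiningMap ρ ρ) : ℂ) ≤
      charInner ρ.character ρ.character := by
  have := Fintype.ofFinite G
  have hcard : (Nat.card G : ℂ) ≠ 0 := by exact_mod_cast Nat.card_pos.ne'
  have := invertibleOfNonzero hcard
  have hfin := ρ.card_inv_mul_sum_char_mul_char_eq_finrank ρ
  have hinner : charInner ρ.character ρ.character =
      (((Nat.card G : ℝ)⁻¹ * ∑ g : G, ‖ρ.character g‖ ^ 2 : ℝ) : ℂ) := by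
    simp [charInner, finsum_eq_sum_of_fintype, Complex.mul_conj']
  have hinv : ∑ g : G, ‖ρ.character g⁻¹‖ ^ 2 = ∑ g : G, ‖ρ.character g‖ ^ 2 :=
    Equiv.sum_comp (Equiv.inv G) fun g => ‖ρ.character g‖ ^ 2
  have hsum : ‖∑ g : G, ρ.character g * ρ.character g⁻¹‖ ≤ ∑ g : G, ‖ρ.character g‖ ^ 2 := by
    calc ‖∑ g : G, ρ.character g * ρ.character g⁻¹‖
        ≤ ∑ g : G, (‖ρ.character g‖ ^ 2 + ‖ρ.character g⁻¹‖ ^ 2) / 2 := by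
          refine norm_sum_le_of_le _ fun g _ => ?_
          rw [norm_mul]
          nlinarith [sq_nonneg (‖ρ.character g‖ - ‖ρ.character g⁻¹‖)]
      _ = ∑ g : G, ‖ρ.character g‖ ^ 2 := by
          rw [← Finset.sum_div, Finset.sum_add_distrib, hinv]
          ring
  have hnorm := congrArg norm hfin
  rw [norm_mul, norm_inv, Complex.norm_natCast, Complex.norm_natCast] at hnorm
  rw [hinner, ← Complex.ofReal_natCast, Complex.real_le_real, ← hnorm]
  gcongr

/-- If a central element does not act by a scalar, then the space of self-intertwiners has
dimension at least two. -/
theorem two_le_finrank_intertwiningMap {k G V : Type*} [Field k] [Group G] [AddCommGroup V]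
    [Module k V] [FiniteDimensional k V] (ρ : Representation k G V) {z : G}
    (hz : ∀ g, g * z = z * g) (hscalar : ∀ c : k, ρ z ≠ c • 1) :
    2 ≤ Module.finrank k (Representation.IntertwiningMap ρ ρ) := by
  let f : Representation.IntertwiningMap ρ ρ :=
    ⟨ρ z, fun g => by
      rw [← Module.End.mul_eq_comp, ← Module.End.mul_eq_comp, ← map_mul, ← map_mul, hz]⟩
  have hli : LinearIndependent k ![Representation.IntertwiningMap.id ρ, f] := by
    rw [LinearIndependent.pair_iff]
    intro s t hst
    have h : s • (1 : V →ₗ[k] V) + t • ρ z = 0 :=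
      congrArg Representation.IntertwiningMap.toLinearMap hst
    have ht : t = 0 := by
      by_contra ht
      refine hscalar (-(t⁻¹ * s)) ?_
      rw [neg_smul, mul_smul, eq_neg_of_add_eq_zero_left h, smul_neg, neg_neg, inv_smul_smul₀ ht]
    refine ⟨?_, ht⟩
    by_contra hs
    have h1 : (1 : V →ₗ[k] V) = 0 := by
      simpa [ht, hs] using h
    exact hscalar 0 (by rw [← mul_one (ρ z), h1, mul_zero, smul_zero])
  simpa using hli.fintype_card_le_finrank

/-- **Step 3 (key observation).** For `n ≥ 3`, `G = S_n` and `K` the centralizer of the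
transposition `(n−1, n)` (so `K ≅ S_{n−2} × S_2`), every faithful irreducible character of
`G` restricts reducibly to `K`: `[α|_K, α|_K]_K ≥ 2`. -/
theorem restriction_to_transposition_centralizer_reducible (n : ℕ) (hn : 3 ≤ n)
    (K : Subgroup (Equiv.Perm (Fin n)))
    (hK : K = Subgroup.centralizer
      {Equiv.swap (⟨n - 2, by omega⟩ : Fin n) (⟨n - 1, by omega⟩ : Fin n)})
    (α : Equiv.Perm (Fin n) → ℂ)
    (hαirr : IsIrrChar (Equiv.Perm (Fin n)) α)
    (hαfaithful : IsFaithfulChar (Equiv.Perm (Fin n)) α) :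
    2 ≤ charInner (fun k : K => α ↑k) (fun k : K => α ↑k) := by
  obtain ⟨V, hinj, hα⟩ := hαfaithful
  set τ := Equiv.swap (⟨n - 2, by omega⟩ : Fin n) (⟨n - 1, by omega⟩ : Fin n) with hτ
  have hcomm : ∀ k : K, (k : Equiv.Perm (Fin n)) * τ = τ * k := fun k =>
    (Subgroup.mem_centralizer_singleton_iff.1 (hK ▸ k.2))
  have hτK : τ ∈ K := hK ▸ Subgroup.mem_centralizer_singleton_iff.2 rfl
  let ρ : Representation ℂ K V := V.ρ.comp K.subtype
  have hscalar : ∀ c : ℂ, ρ ⟨τ, hτK⟩ ≠ c • 1 := by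
    intro c hc
    have hc : V.ρ τ = c • 1 := hc
    let σ := Equiv.swap (⟨0, by omega⟩ : Fin n) (⟨n - 1, by omega⟩ : Fin n)
    have hστ : σ * τ = τ * σ := hinj (by simp [hc])
    have happ := congrArg (fun π : Equiv.Perm (Fin n) => (π ⟨n - 2, by omega⟩ : Fin n).val) hστ
    have h0 : σ ⟨n - 2, by omega⟩ = ⟨n - 2, by omega⟩ :=
      Equiv.swap_apply_of_ne_of_ne (by simp; omega) (by simp; omega)
    simp only [Equiv.Perm.mul_apply, h0, hτ, Equiv.swap_apply_left, σ,
      Equiv.swap_apply_right] at happ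
    omega
  have hchar : (fun k : K => α ↑k) = ρ.character := funext fun k => (hα k).symm
  rw [hchar]
  refine le_trans ?_ (finrank_intertwiningMap_le_charInner ρ)
  exact_mod_cast two_le_finrank_intertwiningMap ρ (z := ⟨τ, hτK⟩)
    (fun g => Subtype.ext (hcomm g)) hscalar
end

section
/- Let n ≥ 5, let Φ be a nontrivial irreducible complex representation of the alternating group A_n, and let t ∈ A_n be a 3-cycle. Then Φ(t) has all three cube roots of unity 1, ω, ω² (where ω = e^{2πi/3}) as eigenvalues. -/
open scoped BigOperators

open Complex

namespace Module.End

variable {V : Type*} [AddCommGroup V] [Module ℂ V]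

theorem hasEigenvalue_of_apply_eq_smul {T : Module.End ℂ V} {μ : ℂ} {x : V} (hx : x ≠ 0)
    (h : T x = μ • x) : T.HasEigenvalue μ :=
  hasEigenvalue_of_hasEigenvector ⟨mem_eigenspace_iff.2 h, hx⟩

/-- A cube root of the identity without fixed vectors is a root of `1 + X + X ^ 2`. -/
theorem one_add_self_add_sq_eq_zero {T : Module.End ℂ V} (hT : T ^ 3 = 1)
    (h : ¬ T.HasEigenvalue 1) : 1 + T + T ^ 2 = 0 := by
  ext x
  by_contra hx
  refine h (hasEigenvalue_of_apply_eq_smul hx ?_)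
  have key : T * (1 + T + T ^ 2) = 1 + T + T ^ 2 := by
    rw [mul_add, mul_add, mul_one, ← sq, ← pow_succ', hT]
    abel
  rw [one_smul]
  exact LinearMap.congr_fun key x

/-- A nontrivial cube root of the identity has a nontrivial eigenvalue. -/
theorem hasEigenvalue_or_hasEigenvalue_sq {T : Module.End ℂ V} (hT : T ^ 3 = 1) (hT1 : T ≠ 1)
    {ω : ℂ} (hω : 1 + ω + ω ^ 2 = 0) : T.HasEigenvalue ω ∨ T.HasEigenvalue (ω ^ 2) := by
  by_contra! hc
  refine hT1 (LinearMap.ext fun x => ?_)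
  have hT3 : T (T (T x)) = x := LinearMap.congr_fun hT x
  have hω3 : ω ^ 3 = 1 := by linear_combination (ω - 1) * hω
  have h2 : T (T x - x) - ω • (T x - x) = 0 := by
    by_contra hx
    refine hc.2 (hasEigenvalue_of_apply_eq_smul hx ?_)
    simp only [map_sub, map_smul, hT3]
    have hω2 : ω ^ 2 = -1 - ω := by linear_combination hω
    rw [hω2]
    match_scalars <;> grind
  have h1 : T x - x = 0 := by
    by_contra hx
    exact hc.1 (hasEigenvalue_of_apply_eq_smul hx (sub_eq_zero.1 h2))
  exact sub_eq_zero.1 h1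

end Module.End

namespace alternatingGroup

/-- The embedding of alternating groups induced by an embedding of finite types. -/
noncomputable def mapEmbedding {α β : Type*} [Fintype α] [DecidableEq α] [Fintype β]
    [DecidableEq β] (ι : α ↪ β) : alternatingGroup α →* alternatingGroup β :=
  ((Equiv.Perm.extendDomainHom (.ofInjective ι ι.injective)).comp (alternatingGroup α).subtype).codRestrict _ fun g => by
    rw [Equiv.Perm.mem_alternatingGroup]
    refine (Equiv.Perm.sign_extendDomain (g : Equiv.Perm α) _).trans ?_
    exact Equiv.Perm.mem_alternatingGroup.1 g.2

theorem mapEmbedding_injective {α β : Type*} [Fintype α] [DecidableEq α] [Fintype β]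
    [DecidableEq β] (ι : α ↪ β) : Function.Injective (mapEmbedding ι) := fun _ _ h =>
  Subtype.ext (Equiv.Perm.extendDomainHom_injective _ (congrArg Subtype.val h))

theorem isThreeCycle_mapEmbedding {α β : Type*} [Fintype α] [DecidableEq α] [Fintype β]
    [DecidableEq β] (ι : α ↪ β) {g : alternatingGroup α}
    (hg : (g : Equiv.Perm α).IsThreeCycle) :
    (mapEmbedding ι g : Equiv.Perm β).IsThreeCycle := by
  exact (Equiv.Perm.cycleType_extendDomain (.ofInjective ι ι.injective)).trans hg

/-- If every 3-cycle of `A₄` acts as a root of `1 + X + X ^ 2`, then some nontrivial element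
acts trivially. -/
theorem exists_ne_one_map_eq_one {A : Type*} [Ring A] [Algebra ℂ A]
    (R : alternatingGroup (Fin 4) →* A)
    (hR : ∀ g : alternatingGroup (Fin 4), (g : Equiv.Perm (Fin 4)).IsThreeCycle →
      1 + R g + R g ^ 2 = 0) : ∃ v, v ≠ 1 ∧ R v = 1 := by
  obtain ⟨t, v, w, hv, ht, hvt, hwt, hvwt, hvv, e1, e2, e3⟩ :
      ∃ t v w : alternatingGroup (Fin 4), v ≠ 1 ∧
        (t : Equiv.Perm (Fin 4)).IsThreeCycle ∧
        ((v * t : alternatingGroup (Fin 4)) : Equiv.Perm (Fin 4)).IsThreeCycle ∧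
        ((w * t : alternatingGroup (Fin 4)) : Equiv.Perm (Fin 4)).IsThreeCycle ∧
        ((v * w * t : alternatingGroup (Fin 4)) : Equiv.Perm (Fin 4)).IsThreeCycle ∧
        v * v = 1 ∧ (v * t) ^ 2 = w * t ^ 2 ∧ (w * t) ^ 2 = v * w * t ^ 2 ∧
        (v * w * t) ^ 2 = v * t ^ 2 := by
    let a : Equiv.Perm (Fin 4) := Equiv.swap 0 1 * Equiv.swap 1 2
    let b : Equiv.Perm (Fin 4) := Equiv.swap 0 1 * Equiv.swap 2 3
    let c : Equiv.Perm (Fin 4) := Equiv.swap 0 2 * Equiv.swap 1 3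
    have ha : a ∈ alternatingGroup (Fin 4) := Equiv.Perm.mem_alternatingGroup.2 (by decide)
    have hb : b ∈ alternatingGroup (Fin 4) := Equiv.Perm.mem_alternatingGroup.2 (by decide)
    have hc : c ∈ alternatingGroup (Fin 4) := Equiv.Perm.mem_alternatingGroup.2 (by decide)
    exact ⟨⟨a, ha⟩, ⟨b, hb⟩, ⟨c, hc⟩,
      fun h => absurd (congrArg Subtype.val h) (show b ≠ 1 by decide),
      card_support_eq_three_iff.1 (show a.support.card = 3 by decide),
      card_support_eq_three_iff.1 (show (b * a).support.card = 3 by decide),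
      card_support_eq_three_iff.1 (show (c * a).support.card = 3 by decide),
      card_support_eq_three_iff.1 (show (b * c * a).support.card = 3 by decide),
      Subtype.ext (show b * b = 1 by decide),
      Subtype.ext (show (b * a) ^ 2 = c * a ^ 2 by decide),
      Subtype.ext (show (c * a) ^ 2 = b * c * a ^ 2 by decide),
      Subtype.ext (show (b * c * a) ^ 2 = b * a ^ 2 by decide)⟩
  refine ⟨v, hv, ?_⟩
  have r0 := hR _ ht
  have r1 := hR _ hvt
  have r2 := hR _ hwt
  have r3 := hR _ hvwt
  rw [← map_pow, e1] at r1
  rw [← map_pow, e2] at r2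
  rw [← map_pow, e3] at r3
  simp only [map_mul, map_pow] at r1 r2 r3
  have hvv' : R v * R v = 1 := by rw [← map_mul, hvv, map_one]
  have h4 : (4 : A) = 1 + 1 + 1 + 1 := by norm_num
  set N := 1 + R v + R w + R v * R w with hN
  have hN4 : N = 4 := by
    have h1 : N * (1 + R t + R t ^ 2) = 0 := by rw [r0, mul_zero]
    have h2 : 4 + N * R t + N * R t ^ 2 = 0 := by
      calc 4 + N * R t + N * R t ^ 2
          = (1 + R t + R t ^ 2) + (1 + R v * R t + R w * R t ^ 2) +
            (1 + R w * R t + R v * R w * R t ^ 2) +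
            (1 + R v * R w * R t + R v * R t ^ 2) := by rw [hN, h4]; noncomm_ring
        _ = 0 := by rw [r0, r1, r2, r3]; simp
    have h3 : N - 4 = N * (1 + R t + R t ^ 2) - (4 + N * R t + N * R t ^ 2) := by noncomm_ring
    rw [h1, h2, sub_zero] at h3
    exact sub_eq_zero.1 h3
  have hvN : R v * N = N := by
    have : R v * N = R v + R v * R v + R v * R w + R v * R v * R w := by
      rw [hN]; noncomm_ring
    rw [this, hvv', hN]
    noncomm_ring
  rw [hN4] at hvN
  have hsmul : (4 : ℂ) • (R v - 1) = 0 := by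
    rw [Algebra.smul_def, map_ofNat, mul_sub, mul_one, sub_eq_zero,
      (Commute.ofNat_left 4 (R v)).eq, hvN]
  exact sub_eq_zero.1 ((smul_eq_zero.1 hsmul).resolve_left (by norm_num))

theorem isSimpleGroup_fin {n : ℕ} (hn : 5 ≤ n) : IsSimpleGroup (alternatingGroup (Fin n)) :=
  alternatingGroup.isSimpleGroup (by simpa using hn)

/-- A representation of `A_n` for `5 ≤ n` is trivial as soon as a nonidentity element acts
trivially. -/
theorem map_eq_one_of_ne_one {n : ℕ} (hn : 5 ≤ n) {M : Type*} [Monoid M]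
    (R : alternatingGroup (Fin n) →* M) {g : alternatingGroup (Fin n)} (hg : g ≠ 1)
    (h : R g = 1) (x : alternatingGroup (Fin n)) : R x = 1 := by
  have := isSimpleGroup_fin hn
  rcases (R.normal_ker).eq_bot_or_eq_top with hk | hk
  · exact absurd (Subgroup.mem_bot.1 (hk ▸ MonoidHom.mem_ker.2 h)) hg
  · exact MonoidHom.mem_ker.1 (hk ▸ Subgroup.mem_top x)

variable {V : Type*} [AddCommGroup V] [Module ℂ V]

theorem _root_.Representation.hasEigenvalue_of_isConj {G : Type*} [Group G]
    (ρ : Representation ℂ G V) {g h : G} (hc : IsConj g h) {μ : ℂ}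
    (hg : Module.End.HasEigenvalue (ρ g) μ) : Module.End.HasEigenvalue (ρ h) μ := by
  obtain ⟨c, rfl⟩ := isConj_iff.1 hc
  obtain ⟨x, hx⟩ := hg.exists_hasEigenvector
  refine Module.End.hasEigenvalue_of_apply_eq_smul (x := ρ c x) ?_ ?_
  · intro h0
    apply hx.2
    rw [← ρ.inv_self_apply c x, h0, map_zero]
  · rw [← Module.End.mul_apply, ← map_mul, inv_mul_cancel_right, map_mul, Module.End.mul_apply,
      hx.apply_eq_smul, map_smul]

theorem _root_.Representation.hasEigenvalue_inv {G : Type*} [Group G]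
    (ρ : Representation ℂ G V) {g : G} {μ ν : ℂ} (hμ : ν * μ = 1)
    (hg : Module.End.HasEigenvalue (ρ g) μ) : Module.End.HasEigenvalue (ρ g⁻¹) ν := by
  obtain ⟨x, hx⟩ := hg.exists_hasEigenvector
  refine Module.End.hasEigenvalue_of_apply_eq_smul hx.2 ?_
  have h : ν • ρ g x = x := by rw [hx.apply_eq_smul, smul_smul, hμ, one_smul]
  conv_lhs => rw [← h]
  rw [map_smul, ρ.inv_self_apply]

/-- In a nontrivial representation of `A_n`, `5 ≤ n`, every 3-cycle has a fixed vector. -/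
theorem hasEigenvalue_one_of_isThreeCycle {n : ℕ} (hn : 5 ≤ n)
    (ρ : Representation ℂ (alternatingGroup (Fin n)) V) (hρ : ∃ g, ρ g ≠ 1)
    {t : alternatingGroup (Fin n)} (ht : (t : Equiv.Perm (Fin n)).IsThreeCycle) :
    Module.End.HasEigenvalue (ρ t) 1 := by
  by_contra hc
  let f := mapEmbedding (Fin.castLEEmb (show 4 ≤ n by omega))
  obtain ⟨v, hv, hv1⟩ := exists_ne_one_map_eq_one (MonoidHom.comp ρ f) fun g hg => by
    have hfg := isThreeCycle_mapEmbedding (Fin.castLEEmb (show 4 ≤ n by omega)) hg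
    refine Module.End.one_add_self_add_sq_eq_zero ?_ fun h => hc ?_
    · rw [← map_pow, show g ^ 3 = 1 from Subtype.ext (hg.orderOf ▸ pow_orderOf_eq_one _), map_one]
    · exact ρ.hasEigenvalue_of_isConj (isThreeCycle_isConj (by simpa using hn) hfg ht) h
  obtain ⟨g, hg⟩ := hρ
  refine hg (map_eq_one_of_ne_one hn ρ (g := f v) (fun h => hv ?_) hv1 g)
  exact mapEmbedding_injective _ (h.trans (map_one f).symm)

/-- In a nontrivial representation of `A_n`, `5 ≤ n`, every primitive cube root of unity is an
eigenvalue of every 3-cycle. -/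
theorem hasEigenvalue_of_isThreeCycle {n : ℕ} (hn : 5 ≤ n)
    (ρ : Representation ℂ (alternatingGroup (Fin n)) V) (hρ : ∃ g, ρ g ≠ 1)
    {t : alternatingGroup (Fin n)} (ht : (t : Equiv.Perm (Fin n)).IsThreeCycle)
    {ω : ℂ} (hω : 1 + ω + ω ^ 2 = 0) :
    Module.End.HasEigenvalue (ρ t) ω ∧ Module.End.HasEigenvalue (ρ t) (ω ^ 2) := by
  have hω3 : ω ^ 3 = 1 := by linear_combination (ω - 1) * hω
  have ht3 : t ^ 3 = 1 := Subtype.ext (ht.orderOf ▸ pow_orderOf_eq_one _)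
  have hT : ρ t ^ 3 = 1 := by rw [← map_pow, ht3, map_one]
  have hT1 : ρ t ≠ 1 := fun h => by
    obtain ⟨g, hg⟩ := hρ
    refine hg (map_eq_one_of_ne_one hn ρ (g := t) ?_ h g)
    rintro rfl
    exact ht.isCycle.ne_one rfl
  have hinv : IsConj t⁻¹ t := isThreeCycle_isConj (by simpa using hn) ht.inv ht
  have key : ∀ μ ν : ℂ, ν * μ = 1 → Module.End.HasEigenvalue (ρ t) μ →
      Module.End.HasEigenvalue (ρ t) ν := fun μ ν h hμ =>
    ρ.hasEigenvalue_of_isConj hinv (ρ.hasEigenvalue_inv h hμ)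
  rcases Module.End.hasEigenvalue_or_hasEigenvalue_sq hT hT1 hω with h | h
  · exact ⟨h, key _ _ (by rw [← hω3]; ring) h⟩
  · exact ⟨key _ _ (by rw [← hω3]; ring) h, h⟩

end alternatingGroup

/-- **Step 5 (eigenvalue claim).** For `n ≥ 5`, any nontrivial irreducible complex
representation `Φ` of `A_n` and any 3-cycle `t ∈ A_n`, the matrix `Φ(t)` has all three cube
roots of unity `1, ω, ω²` (with `ω = e^{2πi/3}`) as eigenvalues. -/
theorem threeCycle_eigenvalues (n : ℕ) (hn : 5 ≤ n)
    (Φ : FDRep ℂ (alternatingGroup (Fin n))) (hirr : CategoryTheory.Simple Φ)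
    (hnontriv : Φ.character ≠ fun _ => Φ.character 1)
    (t : alternatingGroup (Fin n))
    (ht : Equiv.Perm.IsThreeCycle (t : Equiv.Perm (Fin n))) :
    Module.End.HasEigenvalue (Φ.ρ t) 1 ∧
    Module.End.HasEigenvalue (Φ.ρ t) (Complex.exp (2 * Real.pi * Complex.I / 3)) ∧
    Module.End.HasEigenvalue (Φ.ρ t) ((Complex.exp (2 * Real.pi * Complex.I / 3)) ^ 2) := by
  have hρ : ∃ g, Φ.ρ g ≠ 1 := by
    by_contra! h
    refine hnontriv (funext fun g => ?_)
    simp only [FDRep.character, h]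
  have hω : 1 + Complex.exp (2 * Real.pi * Complex.I / 3) +
      Complex.exp (2 * Real.pi * Complex.I / 3) ^ 2 = 0 := by
    have hp := Complex.isPrimitiveRoot_exp 3 (by norm_num)
    simpa [Finset.sum_range_succ] using hp.geom_sum_eq_zero (by norm_num)
  exact ⟨alternatingGroup.hasEigenvalue_one_of_isThreeCycle hn Φ.ρ hρ ht,
    alternatingGroup.hasEigenvalue_of_isThreeCycle hn Φ.ρ hρ ht hω⟩
end
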